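/- Let A be a Γ-graded ring with graded local units and let Ω be a normal subgroup of Γ. Then A is strongly Γ-graded if and only if A is strongly Γ/Ω-graded (with the quotient grading A_{Ωγ} = ⊕_{ω∈Ω} A_{ωγ}) and A_Ω = ⊕_{ω∈Ω} A_ω is strongly Ω-graded. -/

import Mathlib

/-- The product of two additive subgroups of a (possibly nonunital) ring. -/
def AddSubgroup.gradeMul {R : Type*} [NonUnitalRing R] (S T : AddSubgroup R) : AddSubgroup R :=
  AddSubgroup.closure (Set.image2 (· * ·) (S : Set R) (T : Set R))

/-- The quotient grading: for `q ∈ Γ ⧸ Ω`, the component `A_{Ωγ} = ⊕_{ω ∈ Ω} A_{ωγ}`,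
realised as the subgroup of `R` generated (spanned) by the components `A g` with `g ∈ q`. -/
def quotComponent {Γ R : Type*} [Group Γ] [NonUnitalRing R] (Ω : Subgroup Γ) [Ω.Normal]
    (A : Γ → AddSubgroup R) (q : Γ ⧸ Ω) : AddSubgroup R :=
  ⨆ g ∈ {g : Γ | (QuotientGroup.mk g : Γ ⧸ Ω) = q}, A g

theorem AddSubgroup.gradeMul_le {R : Type*} [NonUnitalRing R] {S T U : AddSubgroup R} :
    AddSubgroup.gradeMul S T ≤ U ↔ ∀ s ∈ S, ∀ t ∈ T, s * t ∈ U := by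
  rw [AddSubgroup.gradeMul, AddSubgroup.closure_le, Set.image2_subset_iff]
  rfl

theorem AddSubgroup.mul_mem_gradeMul {R : Type*} [NonUnitalRing R] {S T : AddSubgroup R} {s t : R}
    (hs : s ∈ S) (ht : t ∈ T) : s * t ∈ AddSubgroup.gradeMul S T :=
  AddSubgroup.subset_closure (Set.mem_image2_of_mem hs ht)

theorem AddSubgroup.gradeMul_mono {R : Type*} [NonUnitalRing R] {S S' T T' : AddSubgroup R}
    (hS : S ≤ S') (hT : T ≤ T') : AddSubgroup.gradeMul S T ≤ AddSubgroup.gradeMul S' T' :=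
  AddSubgroup.closure_mono (Set.image2_subset hS hT)

theorem le_quotComponent {Γ R : Type*} [Group Γ] [NonUnitalRing R] (Ω : Subgroup Γ) [Ω.Normal]
    (A : Γ → AddSubgroup R) {q : Γ ⧸ Ω} {g : Γ} (hg : (QuotientGroup.mk g : Γ ⧸ Ω) = q) :
    A g ≤ quotComponent Ω A q :=
  le_iSup₂_of_le (f := fun g (_ : g ∈ {g : Γ | (QuotientGroup.mk g : Γ ⧸ Ω) = q}) => A g)
    g hg le_rfl

/-- A product of quotient components is contained in `U` as soon as the products of the
homogeneous components they are built from are. -/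
theorem gradeMul_quotComponent_le {Γ R : Type*} [Group Γ] [NonUnitalRing R] (Ω : Subgroup Γ)
    [Ω.Normal] (A : Γ → AddSubgroup R) {q r : Γ ⧸ Ω} {U : AddSubgroup R}
    (h : ∀ g k : Γ, (QuotientGroup.mk g : Γ ⧸ Ω) = q → (QuotientGroup.mk k : Γ ⧸ Ω) = r →
      ∀ a ∈ A g, ∀ b ∈ A k, a * b ∈ U) :
    AddSubgroup.gradeMul (quotComponent Ω A q) (quotComponent Ω A r) ≤ U := by
  rw [AddSubgroup.gradeMul_le]
  intro s hs t ht
  have hleft : quotComponent Ω A q ≤ U.comap (AddMonoidHom.mulRight t) := by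
    refine iSup₂_le fun g hg a ha => ?_
    have hright : quotComponent Ω A r ≤ U.comap (AddMonoidHom.mulLeft a) :=
      iSup₂_le fun k hk b hb => h g k hg hk a ha b hb
    exact hright ht
  exact hleft hs

/-- If `1 ∈ Γ` factors as `w⁻¹ * w` at the level of components, then `a * b` with `a` of degree
`γ * w` and `b` of degree `w⁻¹ * δ` lies in `A γ * A δ`, given a right unit of degree `1`
for `a`. -/
theorem mul_mem_gradeMul_of_shift {Γ R : Type*} [Group Γ] [NonUnitalRing R]
    {A : Γ → AddSubgroup R}
    (hgraded : ∀ γ δ : Γ, AddSubgroup.gradeMul (A γ) (A δ) ≤ A (γ * δ)) {γ δ w : Γ}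
    (hw : A 1 ≤ AddSubgroup.gradeMul (A w⁻¹) (A w)) {a b e : R} (ha : a ∈ A (γ * w))
    (hb : b ∈ A (w⁻¹ * δ)) (he : e ∈ A 1) (hae : a * e = a) :
    a * b ∈ AddSubgroup.gradeMul (A γ) (A δ) := by
  have hle : AddSubgroup.gradeMul (A w⁻¹) (A w) ≤ (AddSubgroup.gradeMul (A γ) (A δ)).comap
      ((AddMonoidHom.mulRight b).comp (AddMonoidHom.mulLeft a)) := by
    rw [AddSubgroup.gradeMul_le]
    intro u hu v hv
    have hau : a * u ∈ A γ := by
      simpa using hgraded _ _ (AddSubgroup.mul_mem_gradeMul ha hu)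
    have hvb : v * b ∈ A δ := by
      simpa using hgraded _ _ (AddSubgroup.mul_mem_gradeMul hv hb)
    simpa [mul_assoc] using AddSubgroup.mul_mem_gradeMul hau hvb
  simpa [hae] using hle (hw he)

/-- Let `A` be a `Γ`-graded ring with graded local units and `Ω ⊴ Γ`.
Then `A` is strongly `Γ`-graded iff `A` is strongly `Γ/Ω`-graded (with the quotient grading)
and `A_Ω = ⊕_{ω ∈ Ω} A_ω` is strongly `Ω`-graded. -/
theorem stmt2 {Γ R : Type*} [Group Γ] [DecidableEq Γ] [NonUnitalRing R]
    (Ω : Subgroup Γ) [Ω.Normal]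
    (A : Γ → AddSubgroup R)
    (hdecomp : DirectSum.IsInternal A)
    (hgraded : ∀ γ δ : Γ, AddSubgroup.gradeMul (A γ) (A δ) ≤ A (γ * δ))
    (E : Set R) (hE1 : E ⊆ (A 1 : Set R)) (hEidem : ∀ e ∈ E, e * e = e)
    (hElocal : ∀ F : Finset R, ∃ e ∈ E, ∀ x ∈ F, e * x * e = x) :
    (∀ γ δ : Γ, AddSubgroup.gradeMul (A γ) (A δ) = A (γ * δ)) ↔
      ((∀ q r : Γ ⧸ Ω,
          AddSubgroup.gradeMul (quotComponent Ω A q) (quotComponent Ω A r)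
            = quotComponent Ω A (q * r)) ∧
        (∀ ω₁ ω₂ : Ω,
          AddSubgroup.gradeMul (A ↑ω₁) (A ↑ω₂) = A ↑(ω₁ * ω₂))) := by
  refine ⟨fun h => ⟨fun q r => le_antisymm ?_ ?_, fun ω₁ ω₂ => h ω₁ ω₂⟩, ?_⟩
  · refine gradeMul_quotComponent_le Ω A fun g k hg hk a ha b hb => ?_
    refine le_quotComponent Ω A (g := g * k) ?_
      (hgraded g k (AddSubgroup.mul_mem_gradeMul ha hb))
    rw [QuotientGroup.mk_mul, hg, hk]
  · refine iSup₂_le fun k hk => ?_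
    obtain ⟨g, rfl⟩ := QuotientGroup.mk_surjective q
    have hr : (QuotientGroup.mk (g⁻¹ * k) : Γ ⧸ Ω) = r := by
      rw [QuotientGroup.mk_mul, show (QuotientGroup.mk k : Γ ⧸ Ω) = _ from hk,
        QuotientGroup.mk_inv, inv_mul_cancel_left]
    calc A k = AddSubgroup.gradeMul (A g) (A (g⁻¹ * k)) := by rw [h, mul_inv_cancel_left]
      _ ≤ _ := AddSubgroup.gradeMul_mono (le_quotComponent Ω A rfl) (le_quotComponent Ω A hr)
  · rintro ⟨hquot, hsub⟩ γ δ
    refine le_antisymm (hgraded γ δ) fun x hx => ?_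
    let := hdecomp.chooseDecomposition
    let proj : R →+ R :=
      { toFun := fun y => (DirectSum.decompose A y (γ * δ) : R)
        map_zero' := by simp
        map_add' := by simp }
    have hle : AddSubgroup.gradeMul (quotComponent Ω A γ) (quotComponent Ω A δ) ≤
        (AddSubgroup.gradeMul (A γ) (A δ)).comap proj := by
      refine gradeMul_quotComponent_le Ω A fun g k hg hk a ha b hb => ?_
      have hab : a * b ∈ A (g * k) := hgraded g k (AddSubgroup.mul_mem_gradeMul ha hb)
      change (DirectSum.decompose A (a * b) (γ * δ) : R) ∈ AddSubgroup.gradeMul (A γ) (A δ)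
      by_cases hgk : g * k = γ * δ
      · rw [hgk] at hab
        rw [DirectSum.decompose_of_mem_same A hab]
        obtain ⟨e, he, hea⟩ := hElocal {a}
        have hae : a * e = a := by
          have hea := hea a (Finset.mem_singleton_self a)
          rw [← hea, mul_assoc, hEidem e he]
        have hwΩ : γ⁻¹ * g ∈ Ω := QuotientGroup.eq.mp hg.symm
        refine mul_mem_gradeMul_of_shift hgraded (w := γ⁻¹ * g) ?_ ?_ ?_ (hE1 he) hae
        · simpa using (hsub ⟨γ⁻¹ * g, hwΩ⟩⁻¹ ⟨γ⁻¹ * g, hwΩ⟩).ge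
        · rwa [mul_inv_cancel_left]
        · rwa [mul_inv_rev, inv_inv, mul_assoc, ← hgk, inv_mul_cancel_left]
      · rw [DirectSum.decompose_of_mem_ne A hab hgk]
        exact zero_mem _
    have hx' : (DirectSum.decompose A x (γ * δ) : R) ∈ AddSubgroup.gradeMul (A γ) (A δ) :=
      hle ((hquot γ δ).ge (le_quotComponent Ω A rfl hx))
    rwa [DirectSum.decompose_of_mem_same A hx] at hx'
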